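/- Assume Γ is Q-polynomial with respect to E. Then for every vertex x ∈ X: E x̂ ⋆ E x̂ = ((θ₁ θ*_1 − θ₂ θ*_0 + θ₂ − θ₀) / (|X| (θ₁ − θ₂))) E x̂. -/

import Mathlib

open Matrix Finset
open scoped Classical

/-- A distance-regular graph `Γ` with vertex set `X`, path-length distance
`G.dist`, diameter `d ≥ 2`, and intersection numbers `p h i j`. -/
structure DRG where
  X : Type
  [fin : Fintype X]
  [deceq : DecidableEq X]
  G : SimpleGraph X
  conn : G.Connected
  d : ℕ
  d_ge_two : 2 ≤ d
  dist_le : ∀ x y : X, G.dist x y ≤ d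
  dist_attained : ∃ x y : X, G.dist x y = d
  p : ℕ → ℕ → ℕ → ℕ
  dist_regular : ∀ (h i j : ℕ) (x y : X), G.dist x y = h →
    (Finset.univ.filter fun z => G.dist x z = i ∧ G.dist y z = j).card = p h i j

attribute [instance] DRG.fin DRG.deceq

namespace DRG

variable (Γ : DRG)

/-- `Γ_i(x) = {z : ∂(x,z) = i}`. -/
noncomputable def sphere (x : Γ.X) (i : ℕ) : Finset Γ.X :=
  Finset.univ.filter fun z => Γ.G.dist x z = i

/-- The number of vertices `|X|`, as a real number. -/
noncomputable def n : ℝ := (Fintype.card Γ.X : ℝ)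

/-- The `i`-th distance matrix `A_i`. -/
noncomputable def Ai (i : ℕ) : Matrix Γ.X Γ.X ℝ :=
  Matrix.of fun x y => if Γ.G.dist x y = i then (1 : ℝ) else 0

/-- The adjacency matrix `A = A_1`. -/
noncomputable def A : Matrix Γ.X Γ.X ℝ := Γ.Ai 1

/-- The all-ones matrix `J`. -/
def Jmat : Matrix Γ.X Γ.X ℝ := Matrix.of fun _ _ => (1 : ℝ)

/-- `c_i = p^i_{1,i-1}` (so `c_0 = 0`). -/
noncomputable def c (i : ℕ) : ℝ := (Γ.p i 1 (i - 1) : ℝ)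

/-- `a_i = p^i_{1,i}`. -/
noncomputable def a (i : ℕ) : ℝ := (Γ.p i 1 i : ℝ)

/-- `b_i = p^i_{1,i+1}` (so `b_d = 0`). -/
noncomputable def b (i : ℕ) : ℝ := (Γ.p i 1 (i + 1) : ℝ)

/-- The standard basis vector `x̂`. -/
noncomputable def hatv (x : Γ.X) : Γ.X → ℝ := Pi.single x 1

/-- `x⁺_y = Σ_{z ∈ Γ(x) ∩ Γ_{i+1}(y)} ẑ` where `i = ∂(x,y)`. -/
noncomputable def plusv (x y : Γ.X) : Γ.X → ℝ :=
  ∑ z ∈ Γ.sphere x 1 ∩ Γ.sphere y (Γ.G.dist x y + 1), Γ.hatv z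

/-- `x⁰_y = Σ_{z ∈ Γ(x) ∩ Γ_i(y)} ẑ` where `i = ∂(x,y)`. -/
noncomputable def zerov (x y : Γ.X) : Γ.X → ℝ :=
  ∑ z ∈ Γ.sphere x 1 ∩ Γ.sphere y (Γ.G.dist x y), Γ.hatv z

/-- `x⁻_y = Σ_{z ∈ Γ(x) ∩ Γ_{i-1}(y)} ẑ` where `i = ∂(x,y)`
(for `i = 0` this is the zero vector, matching `Γ_{-1}(y) = ∅`). -/
noncomputable def minusv (x y : Γ.X) : Γ.X → ℝ :=
  ∑ z ∈ Γ.sphere x 1 ∩ Γ.sphere y (Γ.G.dist x y - 1), Γ.hatv z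

/-- The Norton product `u ⋆ v = E (u ∘ v)`, where `∘` is the entrywise
(Hadamard) product of vectors. -/
noncomputable def norton (E : Matrix Γ.X Γ.X ℝ) (u v : Γ.X → ℝ) : Γ.X → ℝ :=
  E *ᵥ (u * v)

/-- `E 0, …, E d` is the sequence of primitive idempotents of the Bose–Mesner
algebra, with `E 0 = |X|⁻¹ J`, and `θ 0, …, θ d` are the corresponding
(mutually distinct) eigenvalues, so that `A = Σ_i θ i • E i`. -/
def IsPrimIdemSeq (E : ℕ → Matrix Γ.X Γ.X ℝ) (θ : ℕ → ℝ) : Prop :=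
  E 0 = (Γ.n)⁻¹ • Γ.Jmat ∧
  ∑ i ∈ Finset.range (Γ.d + 1), E i = 1 ∧
  (∀ i j : ℕ, i ≤ Γ.d → j ≤ Γ.d → E i * E j = if i = j then E i else 0) ∧
  Γ.A = ∑ i ∈ Finset.range (Γ.d + 1), θ i • E i ∧
  (∀ i j : ℕ, i ≤ Γ.d → j ≤ Γ.d → θ i = θ j → i = j)

/-- `q h i j` are the Krein parameters:
`E i ∘ E j = |X|⁻¹ Σ_h q h i j • E h`, with `∘` the entrywise product. -/
def IsKrein (E : ℕ → Matrix Γ.X Γ.X ℝ) (q : ℕ → ℕ → ℕ → ℝ) : Prop :=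
  ∀ i j : ℕ, i ≤ Γ.d → j ≤ Γ.d →
    Matrix.hadamard (E i) (E j) =
      (Γ.n)⁻¹ • ∑ h ∈ Finset.range (Γ.d + 1), q h i j • E h

/-- The ordering `E 1, …, E d` is `Q`-polynomial: for `0 ≤ h,i,j ≤ d`,
`q h i j = 0` if one of `h,i,j` is greater than the sum of the other two, and
`q h i j ≠ 0` if one of `h,i,j` equals the sum of the other two. -/
def IsQPolynomial (q : ℕ → ℕ → ℕ → ℝ) : Prop :=
  ∀ h i j : ℕ, h ≤ Γ.d → i ≤ Γ.d → j ≤ Γ.d →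
    ((i + j < h ∨ h + j < i ∨ h + i < j) → q h i j = 0) ∧
    ((h = i + j ∨ i = h + j ∨ j = h + i) → q h i j ≠ 0)

/-- `ts 0, …, ts d` are the (mutually distinct) dual eigenvalues associated
with `E`, i.e. `E = |X|⁻¹ Σ_i ts i • A i`.  The values `ts (-1)` and
`ts (d+1)` are arbitrary reals (indeterminates). -/
def IsDualEigs (E : Matrix Γ.X Γ.X ℝ) (ts : ℤ → ℝ) : Prop :=
  E = (Γ.n)⁻¹ • ∑ i ∈ Finset.range (Γ.d + 1), ts i • Γ.Ai i

/-- The dual eigenvalues `ts 0, …, ts d` are mutually distinct. -/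
def DualDistinct (ts : ℤ → ℝ) : Prop :=
  ∀ i j : ℕ, i ≤ Γ.d → j ≤ Γ.d → ts i = ts j → i = j

/-- `C(x,y) = E x⁻_y − c_i ((θ*_1 − θ*_{i-1})/(θ*_0 − θ*_i)) E x̂`,
where `i = ∂(x,y)`. -/
noncomputable def Cvec (E : Matrix Γ.X Γ.X ℝ) (ts : ℤ → ℝ) (x y : Γ.X) :
    Γ.X → ℝ :=
  E *ᵥ Γ.minusv x y -
    (Γ.c (Γ.G.dist x y) *
      ((ts 1 - ts ((Γ.G.dist x y : ℤ) - 1)) / (ts 0 - ts (Γ.G.dist x y)))) •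
      (E *ᵥ Γ.hatv x)

/-- `B(x,y) = E x⁺_y − b_i ((θ*_1 − θ*_{i+1})/(θ*_0 − θ*_i)) E x̂`,
where `i = ∂(x,y)`. -/
noncomputable def Bvec (E : Matrix Γ.X Γ.X ℝ) (ts : ℤ → ℝ) (x y : Γ.X) :
    Γ.X → ℝ :=
  E *ᵥ Γ.plusv x y -
    (Γ.b (Γ.G.dist x y) *
      ((ts 1 - ts ((Γ.G.dist x y : ℤ) + 1)) / (ts 0 - ts (Γ.G.dist x y)))) •
      (E *ᵥ Γ.hatv x)

end DRG

namespace DRG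

variable {Γ : DRG}

theorem n_ne_zero (x : Γ.X) : Γ.n ≠ 0 :=
  have : Nonempty Γ.X := ⟨x⟩
  Nat.cast_ne_zero.mpr Fintype.card_ne_zero

theorem IsDualEigs.apply {F : Matrix Γ.X Γ.X ℝ} {ts : ℤ → ℝ} (h : Γ.IsDualEigs F ts)
    (x y : Γ.X) : F x y = (Γ.n)⁻¹ * ts (Γ.G.dist x y) := by
  have hle := Γ.dist_le x y
  unfold IsDualEigs at h
  rw [h]
  simp only [Matrix.smul_apply, Matrix.sum_apply, Ai, Matrix.of_apply, smul_eq_mul, mul_ite,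
    mul_one, mul_zero, Finset.sum_ite_eq, Finset.mem_range]
  rw [if_pos (by omega)]

theorem IsDualEigs.symm {F : Matrix Γ.X Γ.X ℝ} {ts : ℤ → ℝ} (h : Γ.IsDualEigs F ts)
    (x y : Γ.X) : F x y = F y x := by
  rw [h.apply, h.apply, SimpleGraph.dist_comm]

/-- The `(x,x)`-entry of `A F`, when all entries `F z x` with `z` adjacent to `x` equal `r`. -/
theorem A_mul_apply_self {F : Matrix Γ.X Γ.X ℝ} {x : Γ.X} {r : ℝ}
    (h : ∀ z, Γ.G.dist x z = 1 → F z x = r) :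
    (Γ.A * F) x x = (∑ z, Γ.A x z) * r := by
  rw [Matrix.mul_apply, Finset.sum_mul]
  refine Finset.sum_congr rfl fun z _ => ?_
  by_cases hz : Γ.G.dist x z = 1
  · rw [h z hz]
  · simp only [A, Ai, Matrix.of_apply, if_neg hz, zero_mul]

namespace IsPrimIdemSeq

variable {E : ℕ → Matrix Γ.X Γ.X ℝ} {θ : ℕ → ℝ}

theorem zero_apply (hE : Γ.IsPrimIdemSeq E θ) (x y : Γ.X) : E 0 x y = (Γ.n)⁻¹ := by
  simp [hE.1, Jmat]

theorem A_mul (hE : Γ.IsPrimIdemSeq E θ) {j : ℕ} (hj : j ≤ Γ.d) :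
    Γ.A * E j = θ j • E j := by
  rw [hE.2.2.2.1, Finset.sum_mul, Finset.sum_eq_single j]
  · rw [Matrix.smul_mul, hE.2.2.1 j j hj hj, if_pos rfl]
  · intro i hi hij
    rw [Matrix.smul_mul, hE.2.2.1 i j (by simpa [Nat.lt_succ_iff] using hi) hj, if_neg hij,
      smul_zero]
  · intro h
    exact absurd (Finset.mem_range.mpr (by omega)) h

theorem row_sum (hE : Γ.IsPrimIdemSeq E θ) {j : ℕ} (hj : j ≤ Γ.d) (x : Γ.X) :
    ∑ y, E j x y = if j = 0 then 1 else 0 := by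
  have hn := n_ne_zero x
  have h := congrFun (congrFun (hE.2.2.1 j 0 hj (Nat.zero_le _)) x) x
  simp only [Matrix.mul_apply, hE.zero_apply, ← Finset.sum_mul] at h
  split_ifs at h ⊢ with h0
  · subst h0
    rw [hE.zero_apply] at h
    field_simp at h
    exact h
  · simpa [hn] using h

theorem row_sum_A (hE : Γ.IsPrimIdemSeq E θ) (x : Γ.X) : ∑ z, Γ.A x z = θ 0 := by
  have hn := n_ne_zero x
  have h := congrFun (congrFun (hE.A_mul (Nat.zero_le _)) x) x
  rw [A_mul_apply_self (fun z _ => hE.zero_apply z x), Matrix.smul_apply, hE.zero_apply,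
    smul_eq_mul] at h
  exact mul_right_cancel₀ (inv_ne_zero hn) h

end IsPrimIdemSeq

/-- For a `Q`-polynomial ordering, only `E 0`, `E 1`, `E 2` occur in `E 1 ∘ E 1`. -/
theorem IsKrein.hadamard_one_one {E : ℕ → Matrix Γ.X Γ.X ℝ} {q : ℕ → ℕ → ℕ → ℝ}
    (hq : Γ.IsKrein E q) (hQ : Γ.IsQPolynomial q) :
    Matrix.hadamard (E 1) (E 1) =
      (Γ.n)⁻¹ • (q 0 1 1 • E 0 + q 1 1 1 • E 1 + q 2 1 1 • E 2) := by
  have hd := Γ.d_ge_two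
  rw [hq 1 1 (by omega) (by omega),
    ← Finset.sum_subset (Finset.range_mono (show 3 ≤ Γ.d + 1 by omega))]
  · simp [Finset.sum_range_succ]
  · intro h hh hh'
    simp only [Finset.mem_range] at hh hh'
    rw [((hQ h 1 1 (by omega) (by omega) (by omega)).1 (by omega)), zero_smul]

/-- The square of `E x̂` in the Norton algebra is `|X|⁻¹ q^1_{1,1} E x̂`. -/
theorem norton_self_eq_krein {E : ℕ → Matrix Γ.X Γ.X ℝ} {θ : ℕ → ℝ}
    (hE : Γ.IsPrimIdemSeq E θ) {q : ℕ → ℕ → ℕ → ℝ} (hq : Γ.IsKrein E q)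
    (hQ : Γ.IsQPolynomial q) (x : Γ.X) :
    Γ.norton (E 1) (E 1 *ᵥ Γ.hatv x) (E 1 *ᵥ Γ.hatv x) =
      ((Γ.n)⁻¹ * q 1 1 1) • (E 1 *ᵥ Γ.hatv x) := by
  have hd := Γ.d_ge_two
  have hsq : (E 1 *ᵥ Γ.hatv x) * (E 1 *ᵥ Γ.hatv x) =
      Matrix.hadamard (E 1) (E 1) *ᵥ Γ.hatv x := by
    ext y
    simp [hatv]
  have hmul : E 1 * Matrix.hadamard (E 1) (E 1) = ((Γ.n)⁻¹ * q 1 1 1) • E 1 := by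
    have hE' := hE.2.2.1
    rw [hq.hadamard_one_one hQ, Matrix.mul_smul, Matrix.mul_add, Matrix.mul_add,
      Matrix.mul_smul, Matrix.mul_smul, Matrix.mul_smul, hE' 1 0 (by omega) (by omega),
      hE' 1 1 (by omega) (by omega), hE' 1 2 (by omega) (by omega)]
    simp [smul_smul]
  rw [norton, hsq, Matrix.mulVec_mulVec, hmul, Matrix.smul_mulVec]

section Krein

variable {E : ℕ → Matrix Γ.X Γ.X ℝ} {θ : ℕ → ℝ} {q : ℕ → ℕ → ℕ → ℝ} {ts : ℤ → ℝ}

theorem row_sum_hadamard_one (hE : Γ.IsPrimIdemSeq E θ) (hts : Γ.IsDualEigs (E 1) ts)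
    (x : Γ.X) : ∑ y, Matrix.hadamard (E 1) (E 1) x y = (Γ.n)⁻¹ * ts 0 := by
  have hd := Γ.d_ge_two
  have h := congrFun (congrFun (hE.2.2.1 1 1 (by omega) (by omega)) x) x
  rw [if_pos rfl, Matrix.mul_apply, hts.apply x x, SimpleGraph.dist_self, Nat.cast_zero] at h
  rw [← h]
  exact Finset.sum_congr rfl fun y _ => by rw [Matrix.hadamard_apply, hts.symm y x]

theorem krein_zero_one_one (hE : Γ.IsPrimIdemSeq E θ) (hq : Γ.IsKrein E q)
    (hQ : Γ.IsQPolynomial q) (hts : Γ.IsDualEigs (E 1) ts) (x : Γ.X) :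
    q 0 1 1 = ts 0 := by
  have hd := Γ.d_ge_two
  have h := row_sum_hadamard_one hE hts x
  rw [hq.hadamard_one_one hQ] at h
  simp only [Matrix.smul_apply, Matrix.add_apply, smul_eq_mul, ← Finset.mul_sum,
    Finset.sum_add_distrib] at h
  rw [hE.row_sum (by omega), hE.row_sum (by omega), hE.row_sum (by omega)] at h
  simpa [n_ne_zero x] using h

theorem theta_zero_mul_dual_one (hE : Γ.IsPrimIdemSeq E θ) (hts : Γ.IsDualEigs (E 1) ts)
    (x : Γ.X) : θ 0 * ts 1 = θ 1 * ts 0 := by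
  have hd := Γ.d_ge_two
  have hn := n_ne_zero x
  have h := congrFun (congrFun (hE.A_mul (j := 1) (by omega)) x) x
  rw [A_mul_apply_self (r := (Γ.n)⁻¹ * ts 1)
    (fun z hz => by rw [hts.symm, hts.apply, hz, Nat.cast_one]), hE.row_sum_A,
    Matrix.smul_apply, hts.apply, SimpleGraph.dist_self, smul_eq_mul, Nat.cast_zero] at h
  field_simp at h
  exact h

theorem dual_zero_ne_zero (hE : Γ.IsPrimIdemSeq E θ) (hts : Γ.IsDualEigs (E 1) ts)
    (hts' : Γ.DualDistinct ts) : ts 0 ≠ 0 := by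
  intro h0
  have hd := Γ.d_ge_two
  obtain ⟨x, y, hxy⟩ := Γ.dist_attained
  have h := row_sum_hadamard_one hE hts x
  rw [h0, mul_zero, Finset.sum_eq_zero_iff_of_nonneg
    (fun z _ => by rw [Matrix.hadamard_apply]; exact mul_self_nonneg _)] at h
  have hy := h y (Finset.mem_univ y)
  rw [Matrix.hadamard_apply, mul_self_eq_zero, hts.apply, hxy] at hy
  have hdz : ts Γ.d = 0 := by simpa [n_ne_zero x] using hy
  have := hts' Γ.d 0 le_rfl (Nat.zero_le _) (by rw [hdz, Nat.cast_zero, h0])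
  omega

theorem krein_one_one_one (hE : Γ.IsPrimIdemSeq E θ) (hq : Γ.IsKrein E q)
    (hQ : Γ.IsQPolynomial q) (hts : Γ.IsDualEigs (E 1) ts) (hts' : Γ.DualDistinct ts)
    (x : Γ.X) :
    q 1 1 1 * (θ 1 - θ 2) = θ 1 * ts 1 - θ 2 * ts 0 + θ 2 - θ 0 := by
  have hd := Γ.d_ge_two
  have hn := n_ne_zero x
  have hdiag : E 1 x x = (Γ.n)⁻¹ * ts 0 := by
    rw [hts.apply, SimpleGraph.dist_self, Nat.cast_zero]
  have h1 := congrFun (congrFun (hq.hadamard_one_one hQ) x) x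
  have h2 := A_mul_apply_self (F := Matrix.hadamard (E 1) (E 1)) (x := x)
    (r := ((Γ.n)⁻¹ * ts 1) * ((Γ.n)⁻¹ * ts 1))
    (fun z hz => by rw [Matrix.hadamard_apply, hts.symm, hts.apply, hz, Nat.cast_one])
  rw [hE.row_sum_A, hq.hadamard_one_one hQ, Matrix.mul_smul, Matrix.mul_add, Matrix.mul_add,
    Matrix.mul_smul, Matrix.mul_smul, Matrix.mul_smul, hE.A_mul (by omega),
    hE.A_mul (by omega), hE.A_mul (by omega)] at h2
  simp only [Matrix.hadamard_apply, Matrix.smul_apply, Matrix.add_apply, smul_eq_mul,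
    hdiag, hE.zero_apply, krein_zero_one_one hE hq hQ hts x] at h1 h2
  have h3 := theta_zero_mul_dual_one hE hts x
  refine mul_left_cancel₀ (dual_zero_ne_zero hE hts hts') ?_
  field_simp at h1 h2
  linear_combination θ 2 * h1 + h2 + ts 1 * h3

end Krein

end DRG

/-- Corollary 3.8(i): the `i = 0` case. -/
theorem DRG.norton_self_formula (Γ : DRG) (E : ℕ → Matrix Γ.X Γ.X ℝ) (θ : ℕ → ℝ)
    (hE : Γ.IsPrimIdemSeq E θ)
    (q : ℕ → ℕ → ℕ → ℝ) (hq : Γ.IsKrein E q) (hQ : Γ.IsQPolynomial q)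
    (ts : ℤ → ℝ) (hts : Γ.IsDualEigs (E 1) ts) (hts' : Γ.DualDistinct ts) (x : Γ.X) :
    Γ.norton (E 1) (E 1 *ᵥ Γ.hatv x) (E 1 *ᵥ Γ.hatv x) =
      ((θ 1 * ts 1 - θ 2 * ts 0 + θ 2 - θ 0) / (Γ.n * (θ 1 - θ 2))) •
        (E 1 *ᵥ Γ.hatv x) := by
  have hd := Γ.d_ge_two
  have hn := n_ne_zero x
  have hθ : θ 1 - θ 2 ≠ 0 := sub_ne_zero.mpr fun h =>
    absurd (hE.2.2.2.2 1 2 (by omega) (by omega) h) (by omega)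
  rw [norton_self_eq_krein hE hq hQ, ← krein_one_one_one hE hq hQ hts hts' x]
  congr 1
  field_simp
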